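/- arXiv:2112.13035 — 2 statements merged into one kernel-verified Lean document; each statement's English description precedes it below -/
import Mathlib

section
/- Norm decay for coercive absolutely 1-homogeneous gradient flows: let H be a real Hilbert space, J : H → [0,∞] proper, convex, lower semicontinuous and absolutely 1-homogeneous, coercive with constant λ₁ > 0. Let u₀ ∈ H with u₀ ⊥ N(J), and let u be a strong solution of the gradient flow with initial datum u₀. Then ‖u(t)‖ ≤ max(‖u₀‖ − λ₁·t, 0) for every t ≥ 0. -/
open MeasureTheory Filter Topology
open scoped ENNReal RealInnerProductSpace

variable {H : Type*} [NormedAddCommGroup H] [InnerProductSpace ℝ H] [CompleteSpace H]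

/-- `J` is proper: it is not identically `+∞`. -/
def IsProperFn (J : H → ℝ≥0∞) : Prop := ∃ u, J u ≠ ⊤

/-- Convexity of an `[0,∞]`-valued functional. -/
def IsConvexFn (J : H → ℝ≥0∞) : Prop :=
  ∀ (x y : H) (a b : ℝ), 0 ≤ a → 0 ≤ b → a + b = 1 →
    J (a • x + b • y) ≤ ENNReal.ofReal a * J x + ENNReal.ofReal b * J y

/-- Absolute 1-homogeneity: `J(λu) = |λ|·J(u)`. -/
def AbsOneHomogeneous (J : H → ℝ≥0∞) : Prop :=
  ∀ (c : ℝ) (u : H), J (c • u) = ENNReal.ofReal |c| * J u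

/-- The null space `N(J) = {w : J(w) = 0}`. -/
def NullSpace (J : H → ℝ≥0∞) : Set H := {w | J w = 0}

/-- `u ⊥ N(J)`. -/
def PerpNullSpace (J : H → ℝ≥0∞) (u : H) : Prop := ∀ w ∈ NullSpace J, ⟪u, w⟫ = 0

/-- Coercivity with constant `λ₁`: `λ₁‖w‖ ≤ J(w)` for every `w ⊥ N(J)`. -/
def CoerciveWith (J : H → ℝ≥0∞) (lam : ℝ) : Prop :=
  ∀ w : H, PerpNullSpace J w → ENNReal.ofReal (lam * ‖w‖) ≤ J w

/-- `v ∈ ∂J(u)`: the subdifferential inequality `J(w) ≥ J(u) + ⟨v, w − u⟩` for all `w`. -/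
def MemSubdiffFn (J : H → ℝ≥0∞) (u v : H) : Prop :=
  ∀ w : H, (J u : EReal) + ((⟪v, w - u⟫ : ℝ) : EReal) ≤ (J w : EReal)

/-- A strong solution of the gradient flow `u' ∈ −∂J(u)`: continuous on `[0,∞)`,
locally absolutely continuous on `(0,∞)` (encoded by the fundamental theorem of
calculus with a locally integrable a.e. derivative `u'`), differentiable a.e. with
`−u'(t) ∈ ∂J(u(t))` for a.e. `t > 0`. -/
structure GradientFlowSol (J : H → ℝ≥0∞) where
  u : ℝ → H
  u' : ℝ → H
  cont : ContinuousOn u (Set.Ici 0)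
  locint : ∀ s t : ℝ, 0 < s → s ≤ t → IntervalIntegrable u' volume s t
  fund : ∀ s t : ℝ, 0 < s → s ≤ t → u t - u s = ∫ r in s..t, u' r
  deriv_ae : ∀ᵐ t : ℝ, 0 < t → HasDerivAt u (u' t) t
  subdiff_ae : ∀ᵐ t : ℝ, 0 < t → MemSubdiffFn J (u t) (-u' t)

omit [CompleteSpace H] in
/-- A subgradient pairs with points of the null space like `J` does along the whole line. -/
theorem MemSubdiffFn.toReal_add_inner_le {J : H → ℝ≥0∞} {u v w : H} (h : MemSubdiffFn J u v)
    (hw : J w = 0) : J u ≠ ⊤ ∧ (J u).toReal + ⟪v, w - u⟫ ≤ 0 := by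
  have h1 := h w
  rw [hw] at h1
  have htop : J u ≠ ⊤ := by
    intro hu
    simp [hu] at h1
  refine ⟨htop, ?_⟩
  rw [← ENNReal.ofReal_toReal htop, EReal.coe_ennreal_ofReal,
    max_eq_left ENNReal.toReal_nonneg, EReal.coe_ennreal_zero] at h1
  exact_mod_cast h1

omit [CompleteSpace H] in
theorem AbsOneHomogeneous.map_zero {J : H → ℝ≥0∞} (hhom : AbsOneHomogeneous J) : J 0 = 0 := by
  simpa using hhom 0 0

omit [CompleteSpace H] in
theorem AbsOneHomogeneous.smul_mem_nullSpace {J : H → ℝ≥0∞} (hhom : AbsOneHomogeneous J) (c : ℝ)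
    {w : H} (hw : J w = 0) : J (c • w) = 0 := by
  simp [hhom c w, hw]

omit [CompleteSpace H] in
/-- Subgradients of an absolutely 1-homogeneous functional are orthogonal to its null space. -/
theorem MemSubdiffFn.perpNullSpace {J : H → ℝ≥0∞} (hhom : AbsOneHomogeneous J) {u v : H}
    (h : MemSubdiffFn J u v) : PerpNullSpace J v := by
  intro w hw
  by_contra hne
  have key := (h.toReal_add_inner_le
    (hhom.smul_mem_nullSpace ((⟪v, u⟫ + 1) / ⟪v, w⟫) hw)).2
  rw [inner_sub_right, inner_smul_right, div_mul_cancel₀ _ hne] at key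
  linarith [ENNReal.toReal_nonneg (a := J u)]

omit [CompleteSpace H] in
theorem MemSubdiffFn.mul_norm_le_inner {J : H → ℝ≥0∞} (hhom : AbsOneHomogeneous J) {lam : ℝ}
    (hcoer : CoerciveWith J lam) {u v : H} (hu : PerpNullSpace J u) (h : MemSubdiffFn J u v) :
    lam * ‖u‖ ≤ ⟪v, u⟫ := by
  obtain ⟨htop, hle⟩ := h.toReal_add_inner_le hhom.map_zero
  have h1 := (ENNReal.ofReal_le_iff_le_toReal htop).1 (hcoer u hu)
  rw [zero_sub, inner_neg_right] at hle
  linarith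

/-- The norm of an integral curve is absolutely continuous. -/
theorem absolutelyContinuousOnInterval_norm {E : Type*} [NormedAddCommGroup E] [NormedSpace ℝ E]
    {f f' : ℝ → E} {a b : ℝ}
    (hint : IntervalIntegrable f' volume a b)
    (hf : ∀ x ∈ Set.uIcc a b, ∀ y ∈ Set.uIcc a b, x ≤ y → f y - f x = ∫ r in x..y, f' r) :
    AbsolutelyContinuousOnInterval (fun x ↦ ‖f x‖) a b := by
  have hG := hint.norm.absolutelyContinuousOnInterval_intervalIntegral
    (Set.left_mem_uIcc (a := a) (b := b))
  set G : ℝ → ℝ := fun x ↦ ∫ r in a..x, ‖f' r‖ with hGdef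
  have hdist : ∀ x ∈ Set.uIcc a b, ∀ y ∈ Set.uIcc a b, x ≤ y →
      dist ‖f x‖ ‖f y‖ ≤ dist (G x) (G y) := by
    intro x hx y hy hxy
    have hsub : ∀ z ∈ Set.uIcc a b, IntervalIntegrable (fun r ↦ ‖f' r‖) volume a z :=
      fun z hz ↦ hint.norm.mono_set (Set.uIcc_subset_uIcc_left hz)
    rw [dist_comm, dist_comm (G x), Real.dist_eq, Real.dist_eq, hGdef,
      intervalIntegral.integral_interval_sub_left (hsub y hy) (hsub x hx)]
    calc |‖f y‖ - ‖f x‖| ≤ ‖f y - f x‖ := abs_norm_sub_norm_le _ _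
      _ = ‖∫ r in x..y, f' r‖ := by rw [hf x hx y hy hxy]
      _ ≤ |∫ r in x..y, ‖f' r‖| := intervalIntegral.norm_integral_le_abs_integral_norm
  rw [absolutelyContinuousOnInterval_iff] at hG ⊢
  intro ε hε
  obtain ⟨δ, hδ, h⟩ := hG ε hε
  refine ⟨δ, hδ, fun I hI hlt ↦ (Finset.sum_le_sum fun i hi ↦ ?_).trans_lt (h I hI hlt)⟩
  obtain ⟨hx, hy⟩ := hI.1 i hi
  rcases le_total (I.2 i).1 (I.2 i).2 with hle | hle
  · exact hdist _ hx _ hy hle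
  · simpa only [dist_comm] using hdist _ hy _ hx hle

namespace GradientFlowSol

variable {J : H → ℝ≥0∞}

omit [CompleteSpace H] in
theorem tendsto_nhdsGT_zero (S : GradientFlowSol J) : Tendsto S.u (𝓝[>] 0) (𝓝 (S.u 0)) :=
  (S.cont 0 Set.self_mem_Ici).mono_left (nhdsWithin_mono _ Set.Ioi_subset_Ici_self)

theorem perpNullSpace (S : GradientFlowSol J) (hhom : AbsOneHomogeneous J)
    (h0 : PerpNullSpace J (S.u 0)) {t : ℝ} (ht : 0 < t) : PerpNullSpace J (S.u t) := by
  intro w hw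
  have hconst : ∀ s, 0 < s → s ≤ t → ⟪S.u s, w⟫ = ⟪S.u t, w⟫ := by
    intro s hs hst
    have hint : ⟪w, ∫ r in s..t, S.u' r⟫ = 0 := by
      rw [intervalIntegral.integral_of_le hst, ← integral_inner (S.locint s t hs hst).1]
      refine integral_eq_zero_of_ae ?_
      filter_upwards [ae_restrict_of_ae S.subdiff_ae, ae_restrict_mem measurableSet_Ioc]
        with r hr hrs
      have := (hr (hs.trans hrs.1)).perpNullSpace hhom w hw
      simpa [real_inner_comm] using this
    rw [← S.fund s t hs hst, inner_sub_right] at hint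
    rw [real_inner_comm, real_inner_comm w (S.u t)]
    linarith
  refine tendsto_nhds_unique (f := fun s ↦ ⟪S.u s, w⟫) (l := 𝓝[>] (0 : ℝ)) ?_
    (by simpa only [h0 w hw] using
      S.tendsto_nhdsGT_zero.inner (𝕜 := ℝ) (tendsto_const_nhds (x := w)))
  refine tendsto_const_nhds.congr' ?_
  filter_upwards [Ioc_mem_nhdsGT ht] with s hs
  exact (hconst s hs.1 hs.2).symm

omit [CompleteSpace H] in
theorem absolutelyContinuousOnInterval_norm (S : GradientFlowSol J) {s t : ℝ} (hs : 0 < s)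
    (hst : s ≤ t) : AbsolutelyContinuousOnInterval (fun r ↦ ‖S.u r‖) s t := by
  refine _root_.absolutelyContinuousOnInterval_norm (S.locint s t hs hst) fun x hx y _ hxy ↦ ?_
  rw [Set.uIcc_of_le hst] at hx
  exact S.fund x y (hs.trans_le hx.1) hxy

theorem deriv_norm_le (S : GradientFlowSol J) (hhom : AbsOneHomogeneous J) {lam : ℝ}
    (hcoer : CoerciveWith J lam) (h0 : PerpNullSpace J (S.u 0)) :
    ∀ᵐ t : ℝ, 0 < t → S.u t ≠ 0 → deriv (fun r ↦ ‖S.u r‖) t ≤ -lam := by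
  filter_upwards [S.deriv_ae, S.subdiff_ae] with t hd hsub ht hne
  have hpos := norm_pos_iff.2 hne
  have hle := (hsub ht).mul_norm_le_inner hhom hcoer (S.perpNullSpace hhom h0 ht)
  have hsqrt := (hd ht).norm_sq.sqrt (by positivity)
  simp only [Real.sqrt_sq (norm_nonneg _)] at hsqrt
  rw [hsqrt.deriv, div_le_iff₀ (by positivity), real_inner_comm]
  rw [inner_neg_left] at hle
  linarith

omit [CompleteSpace H] in
/-- The norm decreases at rate at least `c` across an interval where its derivative is
almost everywhere at most `-c`. -/
theorem norm_le_sub_of_deriv_le (S : GradientFlowSol J) {s t c : ℝ} (hs : 0 < s) (hst : s ≤ t)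
    (h : ∀ᵐ r : ℝ, r ∈ Set.Icc s t → deriv (fun r ↦ ‖S.u r‖) r ≤ -c) :
    ‖S.u t‖ ≤ ‖S.u s‖ - c * (t - s) := by
  have hac := S.absolutelyContinuousOnInterval_norm hs hst
  have hle : ∫ r in s..t, deriv (fun r ↦ ‖S.u r‖) r ≤ ∫ _ in s..t, -c :=
    intervalIntegral.integral_mono_ae_restrict hst hac.intervalIntegrable_deriv
      intervalIntegrable_const ((ae_restrict_iff' measurableSet_Icc).2 h)
  rw [hac.integral_deriv_eq_sub, intervalIntegral.integral_const, smul_eq_mul] at hle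
  linarith

theorem norm_antitone (S : GradientFlowSol J) (hhom : AbsOneHomogeneous J) {lam : ℝ}
    (hlam : 0 ≤ lam) (hcoer : CoerciveWith J lam) (h0 : PerpNullSpace J (S.u 0)) {s t : ℝ}
    (hs : 0 < s) (hst : s ≤ t) : ‖S.u t‖ ≤ ‖S.u s‖ := by
  suffices h : ∀ᵐ r : ℝ, r ∈ Set.Icc s t → deriv (fun r ↦ ‖S.u r‖) r ≤ -0 by
    simpa using S.norm_le_sub_of_deriv_le hs hst h
  filter_upwards [S.deriv_norm_le hhom hcoer h0] with r hr hrs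
  by_cases hzero : S.u r = 0
  · have hmin : IsLocalMin (fun r ↦ ‖S.u r‖) r :=
      Eventually.of_forall fun x ↦ by simp [hzero]
    simp [hmin.deriv_eq_zero]
  · linarith [hr (hs.trans_le hrs.1) hzero]

end GradientFlowSol

/-- norm decay: for a proper, convex, lsc, absolutely 1-homogeneous,
coercive functional `J`, the gradient flow starting from `u₀ ⊥ N(J)` satisfies
`‖u(t)‖ ≤ max(‖u₀‖ − λ₁ t, 0)` for all `t ≥ 0`. -/
theorem gradient_flow_norm_decay {H : Type*} [NormedAddCommGroup H]
    [InnerProductSpace ℝ H] [CompleteSpace H] (J : H → ℝ≥0∞)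
    (hproper : IsProperFn J) (hconv : IsConvexFn J) (hlsc : LowerSemicontinuous J)
    (hhom : AbsOneHomogeneous J) (lam : ℝ) (hlam : 0 < lam) (hcoer : CoerciveWith J lam)
    (u₀ : H) (hperp : PerpNullSpace J u₀)
    (S : GradientFlowSol J) (hinit : S.u 0 = u₀) :
    ∀ t : ℝ, 0 ≤ t → ‖S.u t‖ ≤ max (‖u₀‖ - lam * t) 0 := by
  subst hinit
  intro t ht
  rcases ht.eq_or_lt with rfl | ht
  · simp
  by_cases hzero : S.u t = 0
  · simp [hzero]
  refine le_max_of_le_left ?_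
  have hlim : Tendsto (fun s ↦ ‖S.u s‖ - lam * (t - s)) (𝓝[>] 0) (𝓝 (‖S.u 0‖ - lam * (t - 0))) :=
    S.tendsto_nhdsGT_zero.norm.sub (tendsto_const_nhds.mul
      (tendsto_const_nhds.sub (tendsto_id.mono_left nhdsWithin_le_nhds)))
  rw [sub_zero] at hlim
  refine ge_of_tendsto hlim ?_
  filter_upwards [Ioc_mem_nhdsGT ht] with s hs
  refine S.norm_le_sub_of_deriv_le hs.1 hs.2 ?_
  filter_upwards [S.deriv_norm_le hhom hcoer hperp] with r hr hrs
  have hr0 := hs.1.trans_le hrs.1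
  refine hr hr0 (norm_pos_iff.1 ?_)
  exact (norm_pos_iff.2 hzero).trans_le
    (S.norm_antitone hhom hlam.le hcoer hperp hr0 hrs.2)
end

section
/- Explicit solution of the Neumann total variation flow for the characteristic function of an interior interval: let L > 0, 0 < a < b < L with L < a + b, and k > 0. Set T₁ := k·(b−a)·(L−b)/(2L−(a+b)) and T₂ := (a·(L−a)/L)·((k − 2T₁/(b−a)) − T₁/a). Define u : [0,∞) → L²(0,L) by u(t) := (t/a)·χ_{(0,a)} + (k − 2t/(b−a))·χ_{(a,b)} + (t/(L−b))·χ_{(b,L)} for 0 ≤ t ≤ T₁; u(t) := (T₁/a + s/a)·χ_{(0,a)} + ((k − 2T₁/(b−a)) − s/(L−a))·χ_{(a,L)} with s := t − T₁ for T₁ ≤ t ≤ T₁ + T₂; and u(t) := ((T₁ + T₂)/a)·χ_{(0,L)} for t ≥ T₁ + T₂. Then u is a strong solution of the Neumann total variation flow on (0,L) with initial datum u₀ = k·χ_{(a,b)}. -/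
open MeasureTheory Set Filter Topology
open scoped ENNReal

/-- Lebesgue measure on the interval `(0, L)`. -/
noncomputable def muI (L : ℝ) : Measure ℝ := volume.restrict (Set.Ioo 0 L)

/-- The total variation energy `F : L²(0,L) → [0,∞]`,
`F(w) = sup { ∫_0^L w φ' : φ ∈ C_c^∞(0,L), ‖φ‖_∞ ≤ 1 }`. -/
noncomputable def Fneu (L : ℝ) (w : ℝ → ℝ) : ℝ≥0∞ :=
  ⨆ (φ : ℝ → ℝ) (_ : ContDiff ℝ (⊤ : ℕ∞) φ ∧ HasCompactSupport φ ∧ tsupport φ ⊆ Set.Ioo 0 L ∧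
      ∀ x, |φ x| ≤ 1),
    ENNReal.ofReal (∫ x in Set.Ioo 0 L, w x * deriv φ x)

/-- `v ∈ ∂F(u)`: the subdifferential inequality
`F(w) ≥ F(u) + ∫_0^L v·(w−u)` for all `w ∈ L²(0,L)`. -/
def MemSubdiffNeu (L : ℝ) (u v : Lp ℝ 2 (muI L)) : Prop :=
  ∀ w : Lp ℝ 2 (muI L),
    (Fneu L u : EReal) + ((∫ x, v x * (w x - u x) ∂(muI L) : ℝ) : EReal) ≤
      (Fneu L w : EReal)

/-- A strong solution of the Neumann total variation flow `u' ∈ −∂F(u)` on `(0,L)`: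
continuous on `[0,∞)`, locally absolutely continuous on `(0,∞)` (encoded by the
fundamental theorem of calculus with a locally integrable a.e. derivative `u'`),
differentiable a.e. with `−u'(t) ∈ ∂F(u(t))` for a.e. `t > 0`. -/
structure NeumannTVFlowSol (L : ℝ) where
  u : ℝ → Lp ℝ 2 (muI L)
  u' : ℝ → Lp ℝ 2 (muI L)
  cont : ContinuousOn u (Set.Ici 0)
  locint : ∀ s t : ℝ, 0 < s → s ≤ t → IntervalIntegrable u' volume s t
  fund : ∀ s t : ℝ, 0 < s → s ≤ t → u t - u s = ∫ r in s..t, u' r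
  deriv_ae : ∀ᵐ t : ℝ, 0 < t → HasDerivAt u (u' t) t
  subdiff_ae : ∀ᵐ t : ℝ, 0 < t → MemSubdiffNeu L (u t) (-u' t)

/-- A smooth function rising from `0` to `1` inside the open interval `(p, q)`. -/
structure IsRamp (p q : ℝ) (Φ : ℝ → ℝ) : Prop where
  contDiff : ContDiff ℝ (⊤ : ℕ∞) Φ
  nonneg : ∀ x, 0 ≤ Φ x
  le_one : ∀ x, Φ x ≤ 1
  eq_zero : ∃ p' > p, ∀ x ≤ p', Φ x = 0
  eq_one : ∃ q' < q, ∀ x ≥ q', Φ x = 1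

/-- Smooth ramps on `(p, q)` whose derivatives converge boundedly to the normalized indicator. -/
lemma exists_ramp_seq {p q : ℝ} (hpq : p < q) :
    ∃ (Φ : ℕ → ℝ → ℝ) (C : ℝ), (∀ᶠ n in atTop, IsRamp p q (Φ n) ∧ ∀ x, |deriv (Φ n) x| ≤ C) ∧
      ∀ x, Tendsto (fun n => deriv (Φ n) x) atTop
        (𝓝 ((Ioo p q).indicator (fun _ => 1 / (q - p)) x)) := by
  set θ : ℕ → ℝ → ℝ := fun n x =>
    Real.smoothTransition (n * (x - p) - 1) * Real.smoothTransition (n * (q - x) - 1) with hθ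
  have θ_smooth : ∀ n, ContDiff ℝ (⊤ : ℕ∞) (θ n) := fun n =>
    (Real.smoothTransition.contDiff.comp (by fun_prop)).mul
      (Real.smoothTransition.contDiff.comp (by fun_prop))
  have θ_cont : ∀ n, Continuous (θ n) := fun n => (θ_smooth n).continuous
  have θ_nonneg : ∀ n x, 0 ≤ θ n x := fun n x =>
    mul_nonneg (Real.smoothTransition.nonneg _) (Real.smoothTransition.nonneg _)
  have θ_le : ∀ n x, θ n x ≤ 1 := fun n x =>
    mul_le_one₀ (Real.smoothTransition.le_one _) (Real.smoothTransition.nonneg _)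
      (Real.smoothTransition.le_one _)
  have θ_left : ∀ (n : ℕ) x, (n : ℝ) * (x - p) ≤ 1 → θ n x = 0 := fun n x h => by
    simp [hθ, Real.smoothTransition.zero_of_nonpos (sub_nonpos.2 h)]
  have θ_right : ∀ (n : ℕ) x, (n : ℝ) * (q - x) ≤ 1 → θ n x = 0 := fun n x h => by
    simp [hθ, Real.smoothTransition.zero_of_nonpos (sub_nonpos.2 h)]
  have transition_one : ∀ y : ℝ, 0 < y →
      ∀ᶠ n : ℕ in atTop, Real.smoothTransition (n * y - 1) = 1 := fun y hy => by
    have := (tendsto_natCast_atTop_atTop (R := ℝ)).atTop_mul_const hy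
    filter_upwards [this.eventually_ge_atTop 2] with n hn
    exact Real.smoothTransition.one_of_one_le (by linarith)
  have θ_lim : ∀ x, Tendsto (fun n => θ n x) atTop (𝓝 ((Ioo p q).indicator (fun _ => 1) x)) := by
    intro x
    apply tendsto_nhds_of_eventually_eq
    by_cases hx : x ∈ Ioo p q
    · filter_upwards [transition_one (x - p) (sub_pos.2 hx.1),
        transition_one (q - x) (sub_pos.2 hx.2)] with n h1 h2
      simp [hθ, h1, h2, hx.1, hx.2]
    · rw [indicator_of_notMem hx]
      refine .of_forall fun n => ?_
      rcases not_and_or.1 hx with h | h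
      · exact θ_left n x (by nlinarith [n.cast_nonneg (α := ℝ)])
      · exact θ_right n x (by nlinarith [n.cast_nonneg (α := ℝ)])
  have I_lim : Tendsto (fun n => ∫ x in p..q, θ n x) atTop (𝓝 (q - p)) := by
    have h := intervalIntegral.tendsto_integral_filter_of_dominated_convergence
      (μ := volume) (a := p) (b := q) (l := atTop) (F := θ)
      (f := (Ioo p q).indicator (fun _ => 1)) (fun _ => 1)
      (.of_forall fun n => (θ_cont n).aestronglyMeasurable)
      (.of_forall fun n => .of_forall fun x _ => by
        rw [Real.norm_of_nonneg (θ_nonneg n x)]; exact θ_le n x)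
      (by simp) (.of_forall fun x _ => θ_lim x)
    convert h using 2
    rw [intervalIntegral.integral_of_le hpq.le, integral_Ioc_eq_integral_Ioo,
      setIntegral_indicator measurableSet_Ioo]
    simp [hpq.le]
  have Φ_deriv : ∀ n x, HasDerivAt (fun x => (∫ y in p..x, θ n y) / ∫ y in p..q, θ n y)
      (θ n x / ∫ y in p..q, θ n y) x := fun n x =>
    ((θ_cont n).integral_hasStrictDerivAt p x).hasDerivAt.div_const _
  refine ⟨fun n x => (∫ y in p..x, θ n y) / ∫ y in p..q, θ n y, 2 / (q - p), ?_, ?_⟩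
  · have hI := I_lim.eventually_const_lt (show (q - p) / 2 < q - p by linarith)
    filter_upwards [hI, eventually_gt_atTop 0] with n hn n_pos
    have hn0 : (0 : ℝ) < n := by exact_mod_cast n_pos
    have I_pos : 0 < ∫ y in p..q, θ n y := by linarith
    have hd : ∀ x, deriv (fun x => (∫ y in p..x, θ n y) / ∫ y in p..q, θ n y) x =
        θ n x / ∫ y in p..q, θ n y := fun x => (Φ_deriv n x).deriv
    have left : ∀ x ≤ p + 1 / n, (∫ y in p..x, θ n y) / ∫ y in p..q, θ n y = 0 := by
      intro x hx
      rw [intervalIntegral.integral_zero_ae, zero_div]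
      refine .of_forall fun y hy => θ_left n y ?_
      have h1 : y ≤ p + 1 / n := hy.2.trans (max_le (by simp) hx)
      calc (n : ℝ) * (y - p) ≤ n * (1 / n) := by gcongr; linarith
        _ = 1 := by field_simp
    have right : ∀ x ≥ q - 1 / n, (∫ y in p..x, θ n y) / ∫ y in p..q, θ n y = 1 := by
      intro x hx
      rw [div_eq_one_iff_eq I_pos.ne',
        ← intervalIntegral.integral_add_adjacent_intervals (b := q)
          ((θ_cont n).intervalIntegrable _ _) ((θ_cont n).intervalIntegrable _ _),
        add_eq_left]
      refine intervalIntegral.integral_zero_ae (.of_forall fun y hy => θ_right n y ?_)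
      have h1 : q - 1 / n ≤ y := le_trans (le_min (by simp) hx) hy.1.le
      calc (n : ℝ) * (q - y) ≤ n * (1 / n) := by gcongr; linarith
        _ = 1 := by field_simp
    have mono : Monotone (fun x => (∫ y in p..x, θ n y) / ∫ y in p..q, θ n y) :=
      monotone_of_deriv_nonneg (fun x => (Φ_deriv n x).differentiableAt) fun x => by
        rw [hd]; exact div_nonneg (θ_nonneg n x) I_pos.le
    refine ⟨⟨?_, ?_, ?_, ⟨p + 1 / n, by simpa using hn0, left⟩,
      ⟨q - 1 / n, by simpa using hn0, right⟩⟩, ?_⟩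
    · refine contDiff_infty_iff_deriv.2 ⟨fun x => (Φ_deriv n x).differentiableAt, ?_⟩
      rw [funext hd]
      exact (θ_smooth n).div_const _
    · intro x
      rcases le_total x (p + 1 / n) with h | h
      · exact (left x h).ge
      · exact (left _ le_rfl).symm.le.trans (mono h)
    · intro x
      rcases le_total x (q - 1 / n) with h | h
      · exact (mono h).trans (right _ le_rfl).le
      · exact (right x h).le
    · intro x
      rw [hd, abs_of_nonneg (div_nonneg (θ_nonneg n x) I_pos.le), div_le_div_iff₀ I_pos (by linarith)]
      nlinarith [θ_le n x]
  · intro x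
    simp only [(Φ_deriv _ x).deriv]
    have e : (Ioo p q).indicator (fun _ => 1 / (q - p)) x =
        (Ioo p q).indicator (fun _ => 1) x / (q - p) := by
      simp only [indicator_apply]
      split_ifs <;> simp
    rw [e]
    exact (θ_lim x).div I_lim (by linarith)

/-- The step function on `(0, L)` with values `y₁`, `y₂`, `y₃` on `(0, a)`, `(a, b)`, `(b, L)`. -/
noncomputable def stepFun (L a b y₁ y₂ y₃ : ℝ) (x : ℝ) : ℝ :=
  (Ioo 0 a).indicator (fun _ => y₁) x + (Ioo a b).indicator (fun _ => y₂) x +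
    (Ioo b L).indicator (fun _ => y₃) x

/-- Three-step test fields with boundary values in `[-1, 1]` give lower bounds for the energy. -/
lemma ofReal_integral_mul_stepFun_le_Fneu {L a b c₁ c₃ : ℝ} (ha : 0 < a) (hab : a < b)
    (hbL : b < L) (hc₁ : |c₁| ≤ 1) (hc₃ : |c₃| ≤ 1) {w : ℝ → ℝ}
    (hw : Integrable w (muI L)) :
    ENNReal.ofReal (∫ x, w x * stepFun L a b (c₁ / a) ((-c₁ - c₃) / (b - a)) (c₃ / (L - b)) x
      ∂(muI L)) ≤ Fneu L w := by
  obtain ⟨Φ₁, C₁, h₁, l₁⟩ := exists_ramp_seq ha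
  obtain ⟨Φ₂, C₂, h₂, l₂⟩ := exists_ramp_seq hab
  obtain ⟨Φ₃, C₃, h₃, l₃⟩ := exists_ramp_seq hbL
  set φ : ℕ → ℝ → ℝ := fun n x => c₁ * Φ₁ n x + (-c₁ - c₃) * Φ₂ n x + c₃ * Φ₃ n x with hφ
  set g : ℕ → ℝ → ℝ := fun n x =>
    c₁ * deriv (Φ₁ n) x + (-c₁ - c₃) * deriv (Φ₂ n) x + c₃ * deriv (Φ₃ n) x
  have φ_deriv : ∀ᶠ n in atTop, deriv (φ n) = g n := by
    filter_upwards [h₁, h₂, h₃] with n ⟨r₁, _⟩ ⟨r₂, _⟩ ⟨r₃, _⟩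
    funext x
    have d₁ := (r₁.contDiff.differentiable (by simp) x).hasDerivAt.const_mul c₁
    have d₂ := (r₂.contDiff.differentiable (by simp) x).hasDerivAt.const_mul (-c₁ - c₃)
    have d₃ := (r₃.contDiff.differentiable (by simp) x).hasDerivAt.const_mul c₃
    exact ((d₁.add d₂).add d₃).deriv
  have lim : Tendsto (fun n => ∫ x, w x * g n x ∂(muI L)) atTop
      (𝓝 (∫ x, w x * stepFun L a b (c₁ / a) ((-c₁ - c₃) / (b - a)) (c₃ / (L - b)) x
        ∂(muI L))) := by
    refine tendsto_integral_filter_of_dominated_convergence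
      (fun x => ‖w x‖ * (|c₁| * C₁ + |-c₁ - c₃| * C₂ + |c₃| * C₃)) (.of_forall fun n => ?_) ?_
      (hw.norm.mul_const _) (.of_forall fun x => ?_)
    · exact hw.aestronglyMeasurable.mul (by fun_prop)
    · filter_upwards [h₁, h₂, h₃] with n ⟨_, r₁⟩ ⟨_, r₂⟩ ⟨_, r₃⟩
      refine .of_forall fun x => ?_
      rw [norm_mul]
      gcongr
      refine (abs_add_three _ _ _).trans ?_
      rw [abs_mul, abs_mul, abs_mul]
      gcongr
      exacts [r₁ x, r₂ x, r₃ x]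
    · have e : stepFun L a b (c₁ / a) ((-c₁ - c₃) / (b - a)) (c₃ / (L - b)) x =
          c₁ * (Ioo 0 a).indicator (fun _ => 1 / (a - 0)) x +
          (-c₁ - c₃) * (Ioo a b).indicator (fun _ => 1 / (b - a)) x +
          c₃ * (Ioo b L).indicator (fun _ => 1 / (L - b)) x := by
        simp only [stepFun, indicator_apply]
        split_ifs <;> ring
      rw [e]
      exact (((l₁ x).const_mul _).add ((l₂ x).const_mul _) |>.add ((l₃ x).const_mul _)).const_mul _
  refine le_of_tendsto (ENNReal.tendsto_ofReal lim) ?_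
  filter_upwards [φ_deriv, h₁, h₂, h₃] with n hd ⟨r₁, _⟩ ⟨r₂, _⟩ ⟨r₃, _⟩
  obtain ⟨p₁, hp₁, z₁⟩ := r₁.eq_zero
  obtain ⟨q₁, hq₁, o₁⟩ := r₁.eq_one
  obtain ⟨p₂, hp₂, z₂⟩ := r₂.eq_zero
  obtain ⟨q₂, hq₂, o₂⟩ := r₂.eq_one
  obtain ⟨p₃, hp₃, z₃⟩ := r₃.eq_zero
  obtain ⟨q₃, hq₃, o₃⟩ := r₃.eq_one
  have supp : tsupport (φ n) ⊆ Icc p₁ q₃ := by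
    refine closure_minimal (fun x hx => ?_) isClosed_Icc
    by_contra h
    apply hx
    rcases not_and_or.1 h with h | h
    · have q : p₁ < q₁ := by
        by_contra! hh
        linarith [z₁ p₁ le_rfl, o₁ p₁ hh]
      simp only [hφ]
      rw [z₁ x (by linarith), z₂ x (by linarith), z₃ x (by linarith)]
      ring
    · have q : p₃ < q₃ := by
        by_contra! hh
        linarith [z₃ p₃ le_rfl, o₃ p₃ hh]
      simp only [hφ]
      rw [o₁ x (by linarith), o₂ x (by linarith), o₃ x (by linarith)]
      ring
  rw [← hd]
  refine le_iSup₂_of_le (φ n) ⟨?_, ?_, ?_, ?_⟩ le_rfl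
  · exact ((contDiff_const.mul r₁.contDiff).add (contDiff_const.mul r₂.contDiff)).add
      (contDiff_const.mul r₃.contDiff)
  · exact HasCompactSupport.of_support_subset_isCompact isCompact_Icc
      (subset_tsupport _ |>.trans supp)
  · exact supp.trans fun x hx => ⟨by linarith [hx.1], by linarith [hx.2]⟩
  · intro x
    rw [abs_le] at hc₁ hc₃ ⊢
    have := r₁.nonneg x; have := r₁.le_one x
    have := r₂.nonneg x; have := r₂.le_one x
    have := r₃.nonneg x; have := r₃.le_one x
    simp only [hφ]
    rcases le_total x a with hxa | hxa
    · rw [z₂ x (by linarith), z₃ x (by linarith)]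
      constructor <;> nlinarith
    rcases le_total x b with hxb | hxb
    · rw [o₁ x (by linarith), z₃ x (by linarith)]
      constructor <;> nlinarith
    · rw [o₁ x (by linarith), o₂ x (by linarith)]
      constructor <;> nlinarith

instance isFiniteMeasure_muI (L : ℝ) : IsFiniteMeasure (muI L) := by
  unfold muI; infer_instance

lemma integral_stepFun_mul {L a b : ℝ} (ha : 0 < a) (hab : a < b) (hbL : b < L) (y₁ y₂ y₃ : ℝ)
    {g : ℝ → ℝ} (hg : Integrable g (muI L)) :
    ∫ x, stepFun L a b y₁ y₂ y₃ x * g x ∂(muI L) =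
      y₁ * (∫ x in Ioo 0 a, g x) + y₂ * (∫ x in Ioo a b, g x) + y₃ * ∫ x in Ioo b L, g x := by
  have key : ∀ p q y : ℝ, Ioo p q ⊆ Ioo 0 L →
      Integrable ((Ioo p q).indicator fun x => y * g x) (muI L) ∧
      ∫ x, (Ioo p q).indicator (fun x => y * g x) x ∂(muI L) = y * ∫ x in Ioo p q, g x := by
    intro p q y h
    refine ⟨(hg.const_mul y).indicator measurableSet_Ioo, ?_⟩
    rw [integral_indicator measurableSet_Ioo, muI, Measure.restrict_restrict measurableSet_Ioo,
      inter_eq_left.2 h, integral_const_mul]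
  obtain ⟨i₁, e₁⟩ := key 0 a y₁ (Ioo_subset_Ioo_right (by linarith))
  obtain ⟨i₂, e₂⟩ := key a b y₂ (Ioo_subset_Ioo (by linarith) (by linarith))
  obtain ⟨i₃, e₃⟩ := key b L y₃ (Ioo_subset_Ioo_left (by linarith))
  rw [← e₁, ← e₂, ← e₃, ← integral_add' i₁ i₂, ← integral_add' (i₁.add i₂) i₃]
  congr 1 with x
  simp only [stepFun, indicator_apply, Pi.add_apply]
  split_ifs <;> ring

lemma integral_stepFun_mul_stepFun {L a b : ℝ} (ha : 0 < a) (hab : a < b) (hbL : b < L)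
    (y₁ y₂ y₃ z₁ z₂ z₃ : ℝ) (hz : Integrable (stepFun L a b z₁ z₂ z₃) (muI L)) :
    ∫ x, stepFun L a b y₁ y₂ y₃ x * stepFun L a b z₁ z₂ z₃ x ∂(muI L) =
      y₁ * (z₁ * a) + y₂ * (z₂ * (b - a)) + y₃ * (z₃ * (L - b)) := by
  have key : ∀ p q z : ℝ, p < q → (∀ x ∈ Ioo p q, stepFun L a b z₁ z₂ z₃ x = z) →
      ∫ x in Ioo p q, stepFun L a b z₁ z₂ z₃ x = z * (q - p) := by
    intro p q z hpq h
    rw [setIntegral_congr_fun measurableSet_Ioo h]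
    simp [hpq.le, mul_comm]
  rw [integral_stepFun_mul ha hab hbL _ _ _ hz, key 0 a z₁ ha, key a b z₂ hab, key b L z₃ hbL,
    sub_zero]
  · intro x hx
    simp [stepFun, not_lt.2 (hab.trans hx.1).le, not_lt.2 hx.1.le, hx.1, hx.2]
  · intro x hx
    simp [stepFun, not_lt.2 hx.2.le, not_lt.2 hx.1.le, hx.1, hx.2]
  · intro x hx
    simp [stepFun, not_lt.2 hx.2.le, not_lt.2 (hx.2.trans hab).le, hx.1, hx.2]

/-- The energy of a step function is at most the sum of its jumps. -/
lemma Fneu_le_of_ae_eq_stepFun {L a b y₁ y₂ y₃ : ℝ} (ha : 0 < a) (hab : a < b) (hbL : b < L)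
    {u : ℝ → ℝ} (hu : u =ᵐ[muI L] stepFun L a b y₁ y₂ y₃) :
    Fneu L u ≤ ENNReal.ofReal (|y₁ - y₂| + |y₃ - y₂|) := by
  refine iSup₂_le fun φ ⟨smooth, compact, supp, bound⟩ => ENNReal.ofReal_le_ofReal ?_
  have hcont : Continuous (deriv φ) := smooth.continuous_deriv (by simp)
  have vanish : ∀ x ∉ Ioo 0 L, φ x = 0 := fun x hx => image_eq_zero_of_notMem_tsupport
    fun h => hx (supp h)
  have ftc : ∀ p q : ℝ, p < q → ∫ x in Ioo p q, deriv φ x = φ q - φ p := by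
    intro p q hpq
    rw [← integral_Ioc_eq_integral_Ioo, ← intervalIntegral.integral_of_le hpq.le,
      intervalIntegral.integral_deriv_eq_sub (fun x _ => smooth.differentiable (by simp) x)
        (hcont.intervalIntegrable _ _)]
  have hint : Integrable (deriv φ) (muI L) :=
    (hcont.continuousOn.integrableOn_compact isCompact_Icc).mono_set Ioo_subset_Icc_self
  have e : ∫ x in Ioo 0 L, u x * deriv φ x =
      ∫ x, stepFun L a b y₁ y₂ y₃ x * deriv φ x ∂(muI L) :=
    integral_congr_ae (hu.mono fun x hx => by simp only [hx])
  rw [e, integral_stepFun_mul ha hab hbL _ _ _ hint, ftc 0 a ha, ftc a b hab, ftc b L hbL,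
    vanish 0 (by simp), vanish L (by simp)]
  calc y₁ * (φ a - 0) + y₂ * (φ b - φ a) + y₃ * (0 - φ b)
      = (y₁ - y₂) * φ a + -((y₃ - y₂) * φ b) := by ring
    _ ≤ |(y₁ - y₂) * φ a| + |(y₃ - y₂) * φ b| := add_le_add (le_abs_self _) (neg_le_abs _)
    _ ≤ |y₁ - y₂| + |y₃ - y₂| := by
      rw [abs_mul, abs_mul]
      exact add_le_add (mul_le_of_le_one_right (abs_nonneg _) (bound a))
        (mul_le_of_le_one_right (abs_nonneg _) (bound b))

/-- A step field with boundary values `c₁`, `-c₃` that is calibrated to the jumps of the step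
function `U` is a subgradient at `U`. -/
lemma memSubdiffNeu_of_calibrated {L a b c₁ c₃ y₁ y₂ y₃ : ℝ} (ha : 0 < a) (hab : a < b)
    (hbL : b < L) (hc₁ : |c₁| ≤ 1) (hc₃ : |c₃| ≤ 1) (h₁ : c₁ * (y₁ - y₂) = |y₁ - y₂|)
    (h₃ : c₃ * (y₃ - y₂) = |y₃ - y₂|) {U V : Lp ℝ 2 (muI L)}
    (hU : U =ᵐ[muI L] stepFun L a b y₁ y₂ y₃)
    (hV : V =ᵐ[muI L] stepFun L a b (c₁ / a) ((-c₁ - c₃) / (b - a)) (c₃ / (L - b))) :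
    MemSubdiffNeu L U V := by
  intro w
  have hVw : Integrable (fun x => V x * w x) (muI L) := (Lp.memLp V).integrable_mul (Lp.memLp w)
  have hVU : Integrable (fun x => V x * U x) (muI L) := (Lp.memLp V).integrable_mul (Lp.memLp U)
  have integ : ∀ z : Lp ℝ 2 (muI L), Integrable z (muI L) := fun z =>
    (Lp.memLp z).integrable one_le_two
  have pairing : ∫ x, V x * U x ∂(muI L) = |y₁ - y₂| + |y₃ - y₂| := by
    change ∫ x, (V * U : ℝ → ℝ) x ∂(muI L) = _
    rw [integral_congr_ae (hV.mul hU)]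
    simp only [Pi.mul_apply]
    rw [integral_stepFun_mul_stepFun ha hab hbL _ _ _ _ _ _ ((integ U).congr hU), ← h₁, ← h₃]
    have : b - a ≠ 0 := by linarith
    have : L - b ≠ 0 := by linarith
    field_simp
    ring
  have lower : ((∫ x, V x * w x ∂(muI L) : ℝ) : EReal) ≤ Fneu L w := by
    have e : ∫ x, V x * w x ∂(muI L) = ∫ x, w x *
        stepFun L a b (c₁ / a) ((-c₁ - c₃) / (b - a)) (c₃ / (L - b)) x ∂(muI L) :=
      integral_congr_ae (hV.mono fun x hx => by simp only [hx, mul_comm])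
    rw [e]
    refine le_trans ?_ (EReal.coe_ennreal_le_coe_ennreal_iff.2
      (ofReal_integral_mul_stepFun_le_Fneu ha hab hbL hc₁ hc₃ (integ w)))
    rw [EReal.coe_ennreal_ofReal]
    exact_mod_cast le_max_left _ _
  have upper : (Fneu L U : EReal) ≤ ((|y₁ - y₂| + |y₃ - y₂| : ℝ) : EReal) := by
    refine (EReal.coe_ennreal_le_coe_ennreal_iff.2
      (Fneu_le_of_ae_eq_stepFun ha hab hbL hU)).trans ?_
    rw [EReal.coe_ennreal_ofReal, max_eq_left (by positivity)]
  have split : ∫ x, V x * (w x - U x) ∂(muI L) =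
      ∫ x, V x * w x ∂(muI L) - (|y₁ - y₂| + |y₃ - y₂|) := by
    rw [← pairing, ← integral_sub hVw hVU]
    simp only [mul_sub]
  refine le_trans ?_ lower
  rw [split]
  calc _ ≤ ((|y₁ - y₂| + |y₃ - y₂| : ℝ) : EReal) +
        ((∫ x, V x * w x ∂(muI L) - (|y₁ - y₂| + |y₃ - y₂|) : ℝ) : EReal) := by gcongr
    _ = _ := by rw [← EReal.coe_add]; congr 1; ring

/-- The step function `stepFun L a b y₁ y₂ y₃` as an element of `L²(0, L)`. -/
noncomputable def stepLp (L a b y₁ y₂ y₃ : ℝ) : Lp ℝ 2 (muI L) :=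
  y₁ • indicatorConstLp 2 (measurableSet_Ioo (a := 0) (b := a)) (measure_ne_top _ _) 1 +
    y₂ • indicatorConstLp 2 (measurableSet_Ioo (a := a) (b := b)) (measure_ne_top _ _) 1 +
    y₃ • indicatorConstLp 2 (measurableSet_Ioo (a := b) (b := L)) (measure_ne_top _ _) 1

lemma stepLp_ae_eq (L a b y₁ y₂ y₃ : ℝ) :
    stepLp L a b y₁ y₂ y₃ =ᵐ[muI L] stepFun L a b y₁ y₂ y₃ := by
  have key : ∀ p q y : ℝ, ⇑(y • indicatorConstLp 2 (measurableSet_Ioo (a := p) (b := q))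
      (measure_ne_top (muI L) _) (1 : ℝ)) =ᵐ[muI L] (Ioo p q).indicator fun _ => y := by
    intro p q y
    refine (Lp.coeFn_smul _ _).trans ?_
    filter_upwards [indicatorConstLp_coeFn (p := 2) (c := (1 : ℝ))
      (hs := measurableSet_Ioo (a := p) (b := q)) (hμs := measure_ne_top (muI L) _)] with x hx
    simp [hx, indicator_apply]
  exact (Lp.coeFn_add _ _).trans
    (((Lp.coeFn_add _ _).trans ((key 0 a y₁).add (key a b y₂))).add (key b L y₃))

lemma stepLp_add (L a b y₁ y₂ y₃ z₁ z₂ z₃ : ℝ) :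
    stepLp L a b y₁ y₂ y₃ + stepLp L a b z₁ z₂ z₃ =
      stepLp L a b (y₁ + z₁) (y₂ + z₂) (y₃ + z₃) := by
  unfold stepLp
  module

lemma smul_stepLp (L a b r y₁ y₂ y₃ : ℝ) :
    r • stepLp L a b y₁ y₂ y₃ = stepLp L a b (r * y₁) (r * y₂) (r * y₃) := by
  unfold stepLp
  module

/-- A piecewise affine curve with a single velocity change at `T₁` and a stop at `T₂`. -/
noncomputable def polygonalCurve {E : Type*} [AddCommGroup E] [Module ℝ E] (T₁ T₂ : ℝ)
    (u₀ p q : E) (t : ℝ) : E :=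
  u₀ + min t T₁ • p + (min (max t T₁) T₂ - T₁) • q

/-- The velocity of `polygonalCurve`. -/
noncomputable def polygonalVelocity {E : Type*} [AddCommGroup E] (T₁ T₂ : ℝ) (p q : E)
    (t : ℝ) : E :=
  (Iio T₁).indicator (fun _ => p) t + (Ico T₁ T₂).indicator (fun _ => q) t

lemma intervalIntegrable_polygonalVelocity {E : Type*} [NormedAddCommGroup E] (T₁ T₂ : ℝ)
    (p q : E) (s t : ℝ) :
    IntervalIntegrable (polygonalVelocity T₁ T₂ p q) volume s t := by
  have key : ∀ (S : Set ℝ) (v : E), MeasurableSet S →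
      IntervalIntegrable (S.indicator fun _ => v) volume s t := fun S v hS =>
    intervalIntegrable_iff.2 ((intervalIntegrable_iff.1
      (intervalIntegrable_const (μ := volume) (a := s) (b := t) (c := v))).indicator hS)
  exact (key _ p measurableSet_Iio).add (key _ q measurableSet_Ico)

section Polygonal

variable {E : Type*} [NormedAddCommGroup E] [NormedSpace ℝ E]

lemma continuous_polygonalCurve (T₁ T₂ : ℝ) (u₀ p q : E) :
    Continuous (polygonalCurve T₁ T₂ u₀ p q) := by
  unfold polygonalCurve
  fun_prop

lemma hasDerivAt_polygonalCurve {T₁ T₂ t : ℝ} (h : T₁ < T₂) (u₀ p q : E) (h₁ : t ≠ T₁)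
    (h₂ : t ≠ T₂) :
    HasDerivAt (polygonalCurve T₁ T₂ u₀ p q) (polygonalVelocity T₁ T₂ p q t) t := by
  rcases h₁.lt_or_gt with h₁ | h₁
  · have d : HasDerivAt (fun s : ℝ => u₀ + s • p) p t := by
      simpa using ((hasDerivAt_id t).smul_const p).const_add u₀
    simp only [polygonalVelocity, indicator_of_mem (mem_Iio.2 h₁),
      indicator_of_notMem (fun hh : t ∈ Ico T₁ T₂ => h₁.not_ge hh.1), add_zero]
    refine d.congr_of_eventuallyEq ?_
    filter_upwards [Iio_mem_nhds h₁] with s hs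
    simp [polygonalCurve, min_eq_left (mem_Iio.1 hs).le, max_eq_right (mem_Iio.1 hs).le,
      min_eq_left h.le]
  rcases h₂.lt_or_gt with h₂ | h₂
  · have d : HasDerivAt (fun s : ℝ => u₀ + T₁ • p + (s - T₁) • q) q t := by
      simpa using (((hasDerivAt_id t).sub_const T₁).smul_const q).const_add (u₀ + T₁ • p)
    simp only [polygonalVelocity, indicator_of_notMem (notMem_Iio.2 h₁.le),
      indicator_of_mem (show t ∈ Ico T₁ T₂ from ⟨h₁.le, h₂⟩), zero_add]
    refine d.congr_of_eventuallyEq ?_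
    filter_upwards [Ioo_mem_nhds h₁ h₂] with s hs
    simp [polygonalCurve, min_eq_right hs.1.le, max_eq_left hs.1.le, min_eq_left hs.2.le]
  · simp only [polygonalVelocity, indicator_of_notMem (notMem_Iio.2 h₁.le),
      indicator_of_notMem (fun hh : t ∈ Ico T₁ T₂ => h₂.not_gt hh.2), zero_add]
    refine (hasDerivAt_const t (u₀ + T₁ • p + (T₂ - T₁) • q)).congr_of_eventuallyEq ?_
    filter_upwards [Ioi_mem_nhds h₂] with s hs
    have hs' : T₁ ≤ s := (h.trans hs).le
    simp [polygonalCurve, min_eq_right hs', max_eq_left hs', min_eq_right (mem_Ioi.1 hs).le]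

lemma integral_polygonalVelocity [CompleteSpace E] {T₁ T₂ : ℝ} (h : T₁ < T₂) (u₀ p q : E)
    (s t : ℝ) :
    ∫ r in s..t, polygonalVelocity T₁ T₂ p q r =
      polygonalCurve T₁ T₂ u₀ p q t - polygonalCurve T₁ T₂ u₀ p q s :=
  integral_eq_of_hasDerivAt_off_countable _ _ (s := {T₁, T₂}) (by simp)
    (continuous_polygonalCurve T₁ T₂ u₀ p q).continuousOn
    (fun x hx => by
      have : x ≠ T₁ ∧ x ≠ T₂ := by simpa using hx.2
      exact hasDerivAt_polygonalCurve h u₀ p q this.1 this.2)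
    (intervalIntegrable_polygonalVelocity T₁ T₂ p q s t)

end Polygonal

/-- explicit solution of the Neumann total variation flow on `(0,L)` with
initial datum `u₀ = k·χ_{(a,b)}`, where `0 < a < b < L` and `L < a + b`.  With
`T₁ = k(b−a)(L−b)/(2L−(a+b))` and `T₂ = (a(L−a)/L)((k − 2T₁/(b−a)) − T₁/a)`:
for `0 ≤ t ≤ T₁`, `u(t) = (t/a)χ_{(0,a)} + (k − 2t/(b−a))χ_{(a,b)} + (t/(L−b))χ_{(b,L)}`;
for `T₁ ≤ t ≤ T₁ + T₂` (with `s = t − T₁`),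
`u(t) = (T₁/a + s/a)χ_{(0,a)} + ((k − 2T₁/(b−a)) − s/(L−a))χ_{(a,L)}`;
and `u(t) = ((T₁+T₂)/a)χ_{(0,L)}` for `t ≥ T₁ + T₂`. -/
theorem neumann_tv_flow_explicit_bump (L a b k T₁ T₂ : ℝ)
    (ha : 0 < a) (hab : a < b) (hbL : b < L) (hsum : L < a + b) (hk : 0 < k)
    (hT₁ : T₁ = k * (b - a) * (L - b) / (2 * L - (a + b)))
    (hT₂ : T₂ = a * (L - a) / L * ((k - 2 * T₁ / (b - a)) - T₁ / a)) :
    ∃ S : NeumannTVFlowSol L,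
      (⇑(S.u 0) =ᵐ[muI L] (Set.Ioo a b).indicator fun _ => k) ∧
      (∀ t : ℝ, 0 ≤ t → t ≤ T₁ →
        ⇑(S.u t) =ᵐ[muI L] fun x =>
          (Set.Ioo 0 a).indicator (fun _ => t / a) x +
          (Set.Ioo a b).indicator (fun _ => k - 2 * t / (b - a)) x +
          (Set.Ioo b L).indicator (fun _ => t / (L - b)) x) ∧
      (∀ t : ℝ, T₁ ≤ t → t ≤ T₁ + T₂ →
        ⇑(S.u t) =ᵐ[muI L] fun x =>
          (Set.Ioo 0 a).indicator (fun _ => T₁ / a + (t - T₁) / a) x +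
          (Set.Ioo a L).indicator (fun _ => (k - 2 * T₁ / (b - a)) - (t - T₁) / (L - a)) x) ∧
      (∀ t : ℝ, T₁ + T₂ ≤ t →
        ⇑(S.u t) =ᵐ[muI L] (Set.Ioo 0 L).indicator fun _ => (T₁ + T₂) / a) := by
  have hL : 0 < L := by linarith
  have hLb : 0 < L - b := by linarith
  have hLa : 0 < L - a := by linarith
  have hba : 0 < b - a := by linarith
  have hD : 0 < 2 * L - (a + b) := by linarith
  have T₁_pos : 0 < T₁ := by rw [hT₁]; positivity
  have merge : k - 2 * T₁ / (b - a) = T₁ / (L - b) := by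
    rw [hT₁]; field_simp; ring
  have lt_merge : T₁ / a < T₁ / (L - b) := div_lt_div_of_pos_left T₁_pos hLb (by linarith)
  have T₂_pos : 0 < T₂ := by
    rw [hT₂, merge]
    have := sub_pos.2 lt_merge
    positivity
  have final : T₁ / (L - b) - T₂ / (L - a) = (T₁ + T₂) / a := by
    rw [hT₂, merge]; field_simp; ring
  set u₀ := stepLp L a b 0 k 0
  set p := stepLp L a b (1 / a) (-2 / (b - a)) (1 / (L - b))
  set q := stepLp L a b (1 / a) (-1 / (L - a)) (-1 / (L - a))
  have hT : T₁ < T₁ + T₂ := by linarith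
  set u := polygonalCurve T₁ (T₁ + T₂) u₀ p q with hu
  have u₁ : ∀ t ≤ T₁, u t = stepLp L a b (t / a) (k - 2 * t / (b - a)) (t / (L - b)) := by
    intro t ht
    simp only [hu, polygonalCurve, u₀, p, q, min_eq_left ht, max_eq_right ht, min_eq_left hT.le,
      smul_stepLp, stepLp_add]
    congr 1 <;> ring
  have u₂ : ∀ t, T₁ ≤ t → t ≤ T₁ + T₂ → u t = stepLp L a b (T₁ / a + (t - T₁) / a)
      ((k - 2 * T₁ / (b - a)) - (t - T₁) / (L - a))
      ((k - 2 * T₁ / (b - a)) - (t - T₁) / (L - a)) := by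
    intro t ht ht'
    simp only [hu, polygonalCurve, u₀, p, q, min_eq_right ht, max_eq_left ht, min_eq_left ht',
      smul_stepLp, stepLp_add]
    congr 1
    · ring
    · ring
    · rw [merge]; ring
  have u₃ : ∀ t, T₁ + T₂ ≤ t →
      u t = stepLp L a b ((T₁ + T₂) / a) ((T₁ + T₂) / a) ((T₁ + T₂) / a) := by
    intro t ht
    have e : u t = u (T₁ + T₂) := by
      simp only [hu, polygonalCurve, min_eq_right (hT.le.trans ht), max_eq_left (hT.le.trans ht),
        min_eq_right ht, min_eq_right hT.le, max_eq_left hT.le, min_self]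
    rw [e, u₂ _ hT.le le_rfl, merge, add_sub_cancel_left, final, ← add_div]
  have ae_ne : ∀ x₀ : ℝ, ∀ᵐ x : ℝ, x ≠ x₀ := fun x₀ => by simp [ae_iff]
  have ae_muI : ∀ᵐ x ∂(muI L), x ∈ Ioo 0 L ∧ x ≠ a ∧ x ≠ b := by
    filter_upwards [ae_restrict_mem measurableSet_Ioo, ae_restrict_of_ae (ae_ne a),
      ae_restrict_of_ae (ae_ne b)] with x h₁ h₂ h₃ using ⟨h₁, h₂, h₃⟩
  have subdiff : ∀ t, 0 < t →
      MemSubdiffNeu L (u t) (-polygonalVelocity T₁ (T₁ + T₂) p q t) := by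
    intro t ht
    rw [← neg_one_smul ℝ]
    rcases lt_or_ge t T₁ with h₁ | h₁
    · have e₁ : t / a ≤ t / (L - b) := div_le_div_of_nonneg_left ht.le hLb (by linarith)
      have e₂ : t / (L - b) ≤ k - 2 * t / (b - a) := by
        have i₁ : t / (L - b) ≤ T₁ / (L - b) := by gcongr
        have i₂ : 2 * t / (b - a) ≤ 2 * T₁ / (b - a) := by gcongr
        linarith
      refine memSubdiffNeu_of_calibrated (c₁ := -1) (c₃ := -1) ha hab hbL (by norm_num)
        (by norm_num) ?_ ?_ (u₁ t h₁.le ▸ stepLp_ae_eq ..) ?_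
      · rw [abs_of_nonpos (by linarith)]; ring
      · rw [abs_of_nonpos (by linarith)]; ring
      · have e : (-1 : ℝ) • polygonalVelocity T₁ (T₁ + T₂) p q t =
            stepLp L a b (-1 / a) ((-(-1) - -1) / (b - a)) (-1 / (L - b)) := by
          simp only [polygonalVelocity, p, indicator_of_mem (mem_Iio.2 h₁),
            indicator_of_notMem (fun hh : t ∈ Ico T₁ (T₁ + T₂) => h₁.not_ge hh.1), add_zero,
            smul_stepLp]
          congr 1 <;> ring
        exact e ▸ stepLp_ae_eq ..
    rcases lt_or_ge t (T₁ + T₂) with h₂ | h₂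
    · have e₁ : T₁ / a + (t - T₁) / a ≤ (k - 2 * T₁ / (b - a)) - (t - T₁) / (L - a) := by
        have i₁ : (t - T₁) / a ≤ T₂ / a := by gcongr; linarith
        have i₂ : (t - T₁) / (L - a) ≤ T₂ / (L - a) := by gcongr; linarith
        rw [add_div] at final
        linarith
      refine memSubdiffNeu_of_calibrated (c₁ := -1) (c₃ := (L - b) / (L - a)) ha hab hbL
        (by norm_num) ?_ ?_ (by simp) (u₂ t h₁ h₂.le ▸ stepLp_ae_eq ..) ?_
      · rw [abs_of_pos (by positivity), div_le_one hLa]; linarith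
      · rw [abs_of_nonpos (by linarith)]; ring
      · have e : (-1 : ℝ) • polygonalVelocity T₁ (T₁ + T₂) p q t =
            stepLp L a b (-1 / a) ((-(-1) - (L - b) / (L - a)) / (b - a))
              ((L - b) / (L - a) / (L - b)) := by
          simp only [polygonalVelocity, q, indicator_of_notMem (notMem_Iio.2 h₁),
            indicator_of_mem (show t ∈ Ico T₁ (T₁ + T₂) from ⟨h₁, h₂⟩), zero_add, smul_stepLp]
          congr 1
          · ring
          · field_simp; ring
          · field_simp
        exact e ▸ stepLp_ae_eq ..
    · refine memSubdiffNeu_of_calibrated (c₁ := 0) (c₃ := 0) ha hab hbL (by simp) (by simp)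
        (by simp) (by simp) (u₃ t h₂ ▸ stepLp_ae_eq ..) ?_
      have e : (-1 : ℝ) • polygonalVelocity T₁ (T₁ + T₂) p q t =
          stepLp L a b (0 / a) ((-0 - 0) / (b - a)) (0 / (L - b)) := by
        simp [polygonalVelocity, stepLp, h₁, h₂]
      exact e ▸ stepLp_ae_eq ..
  refine ⟨⟨u, polygonalVelocity T₁ (T₁ + T₂) p q, (continuous_polygonalCurve ..).continuousOn,
    fun s t _ _ => intervalIntegrable_polygonalVelocity ..,
    fun s t _ _ => (integral_polygonalVelocity hT u₀ p q s t).symm, ?_,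
    .of_forall subdiff⟩, ?_, ?_, ?_, ?_⟩
  · filter_upwards [ae_ne T₁, ae_ne (T₁ + T₂)] with t h₁ h₂ _
    exact hasDerivAt_polygonalCurve hT u₀ p q h₁ h₂
  · dsimp only
    rw [u₁ 0 T₁_pos.le]
    refine (stepLp_ae_eq ..).trans (.of_forall fun x => ?_)
    simp [stepFun]
  · intro t _ ht
    dsimp only
    rw [u₁ t ht]
    exact stepLp_ae_eq ..
  · intro t ht ht'
    dsimp only
    rw [u₂ t ht ht']
    refine (stepLp_ae_eq ..).trans ?_
    filter_upwards [ae_muI] with x ⟨hx, _, hxb⟩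
    rcases hxb.lt_or_gt with h | h
    · simp [stepFun, indicator_apply, h, h.trans hbL, h.not_gt]
    · simp [stepFun, indicator_apply, h, h.not_gt, hab.trans h]
  · intro t ht
    dsimp only
    rw [u₃ t ht]
    refine (stepLp_ae_eq ..).trans ?_
    filter_upwards [ae_muI] with x ⟨hx, hxa, hxb⟩
    rw [indicator_of_mem hx]
    rcases hxa.lt_or_gt with h | h
    · simp [stepFun, h, hx.1, h.not_gt, (h.trans hab).not_gt]
    rcases hxb.lt_or_gt with h' | h'
    · simp [stepFun, h, h', h.not_gt, h'.not_gt]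
    · simp [stepFun, h.not_gt, h', h'.not_gt, hx.2]
end
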